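/- (Theorem 2 of the paper.) Let n ≥ 1 and Θ₁, …, Θₙ be measurable spaces with Θ = Θ₁ × ⋯ × Θₙ. For each ℓ ≤ n let Kℓ be a Markov kernel from (∏_{j<ℓ} Θⱼ) × (∏_{j>ℓ} Θⱼ) to Θℓ (the approximate conditional π_{εℓ}(· | sℓ(x*, θ_{<ℓ}, θ_{>ℓ}))), and let G be the Gibbs sweep kernel on Θ which, from state θ, successively for ℓ = 1, …, n replaces the ℓ-th coordinate by a draw from Kℓ evaluated at the already-updated coordinates θ_{<ℓ} and the not-yet-updated coordinates θ_{>ℓ}. Assume that for each ℓ ≤ n there is κℓ < 1/2 with dTV(Kℓ(θ_{<ℓ}, θ_{>ℓ}), Kℓ(θ_{<ℓ}, θ̃_{>ℓ})) ≤ 2κℓ for all θ_{<ℓ} and all θ_{>ℓ}, θ̃_{>ℓ} (the condition for ℓ = n holds vacuously, κₙ = 0). Then G admits a unique stationary probability measure ν_ε on Θ, and for every probability measure ν on Θ and every N ≥ 0, dTV(ν Gᴺ, ν_ε) ≤ (1 − ∏_{ℓ=1}^{n}(1 − 2κℓ))ᴺ · dTV(ν, ν_ε); that is, the ABC-Gibbs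 chain converges geometrically in total variation with per-sweep contraction factor 1 − ∏ℓ(1 − 2κℓ). -/

import Mathlib

open MeasureTheory ProbabilityTheory

/-- Total variation distance between two measures:
`dTV μ ν = sup over measurable sets A of |μ(A) − ν(A)|`. -/
noncomputable def dTV {X : Type*} [MeasurableSpace X] (μ ν : Measure X) : ℝ :=
  ⨆ A : {A : Set X // MeasurableSet A}, |(μ A.1).toReal - (ν A.1).toReal|


section TotalVariation

variable {X : Type*} [MeasurableSpace X]

lemma abs_real_sub_le_dTV (μ ν : Measure X) [IsProbabilityMeasure μ] [IsProbabilityMeasure ν]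
    {A : Set X} (hA : MeasurableSet A) : |μ.real A - ν.real A| ≤ dTV μ ν := by
  refine le_ciSup (f := fun A : {A : Set X // MeasurableSet A} =>
    |(μ A.1).toReal - (ν A.1).toReal|) ⟨1, ?_⟩ ⟨A, hA⟩
  rintro _ ⟨B, rfl⟩
  exact abs_sub_le_of_nonneg_of_le (measureReal_nonneg (μ := μ)) measureReal_le_one
    (measureReal_nonneg (μ := ν)) measureReal_le_one

lemma dTV_le {μ ν : Measure X} {d : ℝ}
    (h : ∀ A, MeasurableSet A → |μ.real A - ν.real A| ≤ d) : dTV μ ν ≤ d :=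
  haveI : Nonempty {A : Set X // MeasurableSet A} := ⟨⟨∅, .empty⟩⟩
  ciSup_le fun A => h A.1 A.2

/-- A one-sided bound over all measurable sets suffices for probability measures. -/
lemma dTV_le_of_sub_le {μ ν : Measure X} [IsProbabilityMeasure μ] [IsProbabilityMeasure ν] {d : ℝ}
    (h : ∀ A, MeasurableSet A → μ.real A - ν.real A ≤ d) : dTV μ ν ≤ d := by
  refine dTV_le fun A hA => abs_le.2 ⟨?_, h A hA⟩
  have := h Aᶜ hA.compl
  rw [probReal_compl_eq_one_sub hA, probReal_compl_eq_one_sub hA] at this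
  linarith

lemma dTV_nonneg (μ ν : Measure X) : 0 ≤ dTV μ ν := Real.iSup_nonneg fun _ => abs_nonneg _

lemma dTV_triangle (μ ν ρ : Measure X) [IsProbabilityMeasure μ] [IsProbabilityMeasure ν]
    [IsProbabilityMeasure ρ] : dTV μ ρ ≤ dTV μ ν + dTV ν ρ :=
  dTV_le fun _ hA => (abs_sub_le _ _ _).trans
    (add_le_add (abs_real_sub_le_dTV μ ν hA) (abs_real_sub_le_dTV ν ρ hA))

lemma eq_of_dTV_le_zero {μ ν : Measure X} [IsProbabilityMeasure μ] [IsProbabilityMeasure ν]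
    (h : dTV μ ν ≤ 0) : μ = ν := by
  ext A hA
  have := abs_nonpos_iff.1 ((abs_real_sub_le_dTV μ ν hA).trans h)
  exact (measureReal_eq_measureReal_iff).1 (sub_eq_zero.1 this)

/-- Two probability measures share a common part whose complement has mass at most `dTV μ ν`. -/
lemma exists_common_part (μ ν : Measure X) [IsProbabilityMeasure μ] [IsProbabilityMeasure ν] :
    ∃ m r r' : Measure X, IsFiniteMeasure m ∧ IsFiniteMeasure r ∧ IsFiniteMeasure r' ∧
      μ = m + r ∧ ν = m + r' ∧ m.real Set.univ = 1 - r.real Set.univ ∧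
      r'.real Set.univ = r.real Set.univ ∧ r.real Set.univ ≤ dTV μ ν := by
  obtain ⟨s, hs⟩ := exists_isHahnDecomposition μ ν
  have hsm := hs.measurableSet
  set m := μ.restrict s + ν.restrict sᶜ with hm
  have hmμ : m ≤ μ := by
    conv_rhs => rw [← Measure.restrict_add_restrict_compl (μ := μ) hsm]
    exact add_le_add le_rfl hs.ge_on_compl
  have hmν : m ≤ ν := by
    conv_rhs => rw [← Measure.restrict_add_restrict_compl (μ := ν) hsm]
    exact add_le_add hs.le_on le_rfl
  have e₁ : μ = m + (μ - m) := by rw [add_comm, Measure.sub_add_cancel_of_le hmμ]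
  have e₂ : ν = m + (ν - m) := by rw [add_comm, Measure.sub_add_cancel_of_le hmν]
  have m₁ : μ.real Set.univ = m.real Set.univ + (μ - m).real Set.univ := by
    conv_lhs => rw [e₁]
    exact measureReal_add_apply
  have m₂ : ν.real Set.univ = m.real Set.univ + (ν - m).real Set.univ := by
    conv_lhs => rw [e₂]
    exact measureReal_add_apply
  have m₃ : m.real Set.univ = μ.real s + ν.real sᶜ := by
    rw [hm, measureReal_add_apply]; simp [measureReal_restrict_apply]
  have hd := (le_abs_self _).trans (abs_real_sub_le_dTV μ ν hsm.compl)
  rw [probReal_univ] at m₁ m₂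
  rw [probReal_compl_eq_one_sub hsm] at hd
  refine ⟨m, μ - m, ν - m, inferInstance, inferInstance, inferInstance, e₁, e₂, ?_, ?_, ?_⟩ <;>
    linarith

lemma integrable_of_mem_Icc {μ : Measure X} [IsFiniteMeasure μ] {g : X → ℝ} (hg : Measurable g)
    (h : ∀ x, g x ∈ Set.Icc (0 : ℝ) 1) : Integrable g μ :=
  .of_bound hg.aestronglyMeasurable 1 (.of_forall fun x => by
    rw [Real.norm_eq_abs, abs_of_nonneg (h x).1]; exact (h x).2)

lemma integral_le_mul_measureReal {μ : Measure X} [IsFiniteMeasure μ] {g : X → ℝ} {C : ℝ}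
    (hg : Integrable g μ) (h : ∀ x, g x ≤ C) : ∫ x, g x ∂μ ≤ C * μ.real Set.univ := by
  calc ∫ x, g x ∂μ ≤ ∫ _, C ∂μ := integral_mono hg (integrable_const C) h
    _ = C * μ.real Set.univ := by simp [mul_comm]

/-- Maximal coupling bound: if `g ≤ g' + c` pointwise, then the integrals against `μ` and `ν`
differ by at most `1 - (1 - c) * (1 - d)` where `d` bounds the total variation distance. -/
lemma integral_sub_integral_le_of_dTV_le {μ ν : Measure X} [IsProbabilityMeasure μ]
    [IsProbabilityMeasure ν] {g g' : X → ℝ} (hg : Measurable g) (hg' : Measurable g')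
    (hI : ∀ x, g x ∈ Set.Icc (0 : ℝ) 1) (hI' : ∀ x, g' x ∈ Set.Icc (0 : ℝ) 1) {c d : ℝ}
    (hc : c ≤ 1) (hgg : ∀ x, g x - g' x ≤ c) (hd : dTV μ ν ≤ d) :
    ∫ x, g x ∂μ - ∫ x, g' x ∂ν ≤ 1 - (1 - c) * (1 - d) := by
  obtain ⟨m, r, r', _, _, _, rfl, rfl, hm, -, hrd⟩ := exists_common_part μ ν
  have ig {ρ : Measure X} [IsFiniteMeasure ρ] : Integrable g ρ := integrable_of_mem_Icc hg hI
  have ig' {ρ : Measure X} [IsFiniteMeasure ρ] : Integrable g' ρ := integrable_of_mem_Icc hg' hI'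
  rw [integral_add_measure ig ig, integral_add_measure ig' ig']
  have h₁ := integral_le_mul_measureReal (μ := m) (ig.sub ig') hgg
  have h₂ := integral_le_mul_measureReal (μ := r) ig fun x => (hI x).2
  have h₃ : 0 ≤ ∫ x, g' x ∂r' := integral_nonneg fun x => (hI' x).1
  simp only [Pi.sub_apply] at h₁
  rw [integral_sub ig ig', hm] at h₁
  nlinarith [mul_le_mul_of_nonneg_left (hrd.trans hd) (sub_nonneg.2 hc)]

/-- A function with oscillation at most `c` has integrals differing by at most `c * dTV μ ν`. -/
lemma integral_sub_integral_le_mul_dTV {μ ν : Measure X} [IsProbabilityMeasure μ]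
    [IsProbabilityMeasure ν] {g : X → ℝ} (hg : Measurable g)
    (hI : ∀ x, g x ∈ Set.Icc (0 : ℝ) 1) {c : ℝ} (hc : 0 ≤ c) (hosc : ∀ x y, g x - g y ≤ c) :
    ∫ x, g x ∂μ - ∫ x, g x ∂ν ≤ c * dTV μ ν := by
  obtain ⟨m, r, r', _, _, _, hμ, hν, -, hrr, hrd⟩ := exists_common_part μ ν
  have ig {ρ : Measure X} [IsFiniteMeasure ρ] : Integrable g ρ := integrable_of_mem_Icc hg hI
  have : Nonempty X := nonempty_of_isProbabilityMeasure μ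
  have hsplit : ∫ x, g x ∂μ - ∫ x, g x ∂ν = ∫ x, g x ∂r - ∫ x, g x ∂r' := by
    conv_lhs => rw [hμ, hν]
    rw [integral_add_measure ig ig, integral_add_measure ig ig]
    ring
  have hbdd : BddBelow (Set.range g) := ⟨0, by rintro _ ⟨x, rfl⟩; exact (hI x).1⟩
  have h₁ := integral_le_mul_measureReal (μ := r) (C := (⨅ y, g y) + c) ig fun x => by
    have : g x - c ≤ ⨅ y, g y := le_ciInf fun y => by linarith [hosc x y]
    linarith
  have h₂ := integral_le_mul_measureReal (μ := r') (C := -⨅ y, g y) ig.neg fun x =>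
    neg_le_neg (ciInf_le hbdd x)
  simp only [Pi.neg_apply] at h₂
  rw [integral_neg, hrr] at h₂
  rw [hsplit]
  nlinarith [mul_le_mul_of_nonneg_left hrd hc]

/-- A setwise limit of probability measures, uniform over measurable sets, is a probability
measure. -/
lemma exists_isProbabilityMeasure_of_uniform_limit (μ : ℕ → Measure X)
    [∀ N, IsProbabilityMeasure (μ N)] (m : Set X → ℝ) (e : ℕ → ℝ)
    (he : Filter.Tendsto e Filter.atTop (nhds 0))
    (h : ∀ N A, MeasurableSet A → |(μ N).real A - m A| ≤ e N) :
    ∃ ν : Measure X, IsProbabilityMeasure ν ∧ ∀ N, dTV (μ N) ν ≤ e N := by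
  have hlim : ∀ A, MeasurableSet A →
      Filter.Tendsto (fun N => (μ N).real A) Filter.atTop (nhds (m A)) := fun A hA =>
    tendsto_iff_dist_tendsto_zero.2
      (squeeze_zero (fun _ => dist_nonneg) (fun N => h N A hA) he)
  have hnonneg : ∀ A, MeasurableSet A → 0 ≤ m A := fun A hA =>
    ge_of_tendsto' (hlim A hA) fun _ => measureReal_nonneg
  have hempty : m ∅ = 0 := tendsto_nhds_unique (hlim ∅ .empty) (by simp)
  have huniv : m Set.univ = 1 := tendsto_nhds_unique (hlim _ .univ) (by simp)
  have hsum : ∀ ⦃f : ℕ → Set X⦄, (∀ i, MeasurableSet (f i)) →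
      Pairwise (Function.onFun Disjoint f) → HasSum (fun i => m (f i)) (m (⋃ i, f i)) := by
    intro f hf hd
    have hfin : ∀ s : Finset ℕ, ∑ i ∈ s, m (f i) = m (⋃ i ∈ s, f i) := fun s => by
      refine tendsto_nhds_unique (tendsto_finsetSum s fun i _ => hlim _ (hf i)) ?_
      have hU := fun N => measureReal_biUnion_finset (μ := μ N) (s := s) (hd.set_pairwise _)
        fun i _ => hf i
      exact (hlim _ (s.measurableSet_biUnion fun i _ => hf i)).congr hU
    refine Metric.tendsto_nhds.2 fun ε hε => ?_
    obtain ⟨N, hN⟩ := (he.eventually_lt_const (show 0 < ε / 3 by positivity)).exists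
    have hμ : HasSum (fun i => (μ N).real (f i)) ((μ N).real (⋃ i, f i)) := by
      have := measure_iUnion (μ := μ N) hd hf
      have hne : ∑' i, (μ N) (f i) ≠ ⊤ := this ▸ measure_ne_top _ _
      rw [measureReal_def, this, ENNReal.tsum_toReal_eq (ENNReal.ne_top_of_tsum_ne_top hne)]
      exact ENNReal.hasSum_toReal hne
    filter_upwards [Metric.tendsto_nhds.1 hμ (ε / 3) (by positivity)] with s hs
    rw [← measureReal_biUnion_finset (hd.set_pairwise _) fun i _ => hf i, Real.dist_eq] at hs
    rw [hfin, Real.dist_eq]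
    have h₁ := h N _ (s.measurableSet_biUnion fun i _ => hf i)
    have h₂ := h N _ (MeasurableSet.iUnion hf)
    rw [abs_le] at h₁ h₂
    rw [abs_lt] at hs ⊢
    constructor <;> linarith
  let ν : Measure X := Measure.ofMeasurable (fun A _ => ENNReal.ofReal (m A)) (by simp [hempty])
    fun f hf hd => by
      rw [← (hsum hf hd).tsum_eq,
        ENNReal.ofReal_tsum_of_nonneg (fun i => hnonneg _ (hf i)) (hsum hf hd).summable]
  have hν : ∀ A, MeasurableSet A → ν A = ENNReal.ofReal (m A) := fun A hA =>
    Measure.ofMeasurable_apply A hA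
  refine ⟨ν, ⟨by rw [hν _ .univ, huniv, ENNReal.ofReal_one]⟩, fun N => dTV_le fun A hA => ?_⟩
  rw [measureReal_def ν, hν A hA, ENNReal.toReal_ofReal (hnonneg A hA)]
  exact h N A hA

end TotalVariation

section Dobrushin

variable {X : Type*} [MeasurableSpace X]

lemma measureReal_bind_kernel {Y : Type*} [MeasurableSpace Y] (Q : Kernel X Y) [IsMarkovKernel Q]
    (μ : Measure X) {A : Set Y} (hA : MeasurableSet A) :
    (μ.bind Q).real A = ∫ x, (Q x).real A ∂μ := by
  rw [measureReal_def, Measure.bind_apply hA Q.aemeasurable]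
  exact (integral_toReal (Q.measurable_coe hA).aemeasurable
    (.of_forall fun x => measure_lt_top _ _)).symm

lemma measurable_kernel_real {Y : Type*} [MeasurableSpace Y] (Q : Kernel X Y)
    {A : Set Y} (hA : MeasurableSet A) : Measurable fun x => (Q x).real A :=
  (Q.measurable_coe hA).ennreal_toReal

lemma dTV_bind_le (Q : Kernel X X) [IsMarkovKernel Q] {c : ℝ} (hc : 0 ≤ c)
    (h : ∀ A, MeasurableSet A → ∀ x y, (Q x).real A - (Q y).real A ≤ c)
    (μ ν : Measure X) [IsProbabilityMeasure μ] [IsProbabilityMeasure ν] :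
    dTV (μ.bind Q) (ν.bind Q) ≤ c * dTV μ ν :=
  dTV_le_of_sub_le fun A hA => by
    rw [measureReal_bind_kernel Q μ hA, measureReal_bind_kernel Q ν hA]
    exact integral_sub_integral_le_mul_dTV (measurable_kernel_real Q hA)
      (fun _ => ⟨measureReal_nonneg, measureReal_le_one⟩) hc (h A hA)

lemma isProbabilityMeasure_iterate_bind (Q : Kernel X X) [IsMarkovKernel Q] (μ : Measure X)
    [hμ : IsProbabilityMeasure μ] (N : ℕ) :
    IsProbabilityMeasure ((fun ρ : Measure X => ρ.bind Q)^[N] μ) := by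
  induction N with
  | zero => exact hμ
  | succ N ih => rw [Function.iterate_succ_apply']; infer_instance

lemma dTV_iterate_bind_le (Q : Kernel X X) [IsMarkovKernel Q] {c : ℝ} (hc : 0 ≤ c)
    (h : ∀ A, MeasurableSet A → ∀ x y, (Q x).real A - (Q y).real A ≤ c)
    (μ ν : Measure X) [IsProbabilityMeasure μ] [IsProbabilityMeasure ν] (N : ℕ) :
    dTV ((fun ρ : Measure X => ρ.bind Q)^[N] μ) ((fun ρ : Measure X => ρ.bind Q)^[N] ν)
      ≤ c ^ N * dTV μ ν := by
  induction N with
  | zero => simp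
  | succ N ih =>
    have := isProbabilityMeasure_iterate_bind Q μ N
    have := isProbabilityMeasure_iterate_bind Q ν N
    simp only [Function.iterate_succ_apply']
    refine (dTV_bind_le Q hc h _ _).trans ?_
    rw [pow_succ', mul_assoc]
    exact mul_le_mul_of_nonneg_left ih hc

/-- A Markov kernel that contracts total variation has an invariant probability measure. -/
lemma exists_invariant_of_contraction [Nonempty X] (Q : Kernel X X) [IsMarkovKernel Q] {c : ℝ}
    (hc : 0 ≤ c) (hc1 : c < 1)
    (h : ∀ A, MeasurableSet A → ∀ x y, (Q x).real A - (Q y).real A ≤ c) :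
    ∃ ν : Measure X, IsProbabilityMeasure ν ∧ ν.bind Q = ν := by
  obtain ⟨x₀⟩ := ‹Nonempty X›
  obtain ⟨μ, hμ, hμs, C, hdist⟩ : ∃ μ : ℕ → Measure X, (∀ N, IsProbabilityMeasure (μ N)) ∧
      (∀ N, μ (N + 1) = (μ N).bind Q) ∧ ∃ C, ∀ N, dTV (μ N) (μ (N + 1)) ≤ c ^ N * C := by
    have hstart (N : ℕ) := dTV_iterate_bind_le Q hc h (Measure.dirac x₀)
      ((Measure.dirac x₀).bind Q) N
    have hprob := isProbabilityMeasure_iterate_bind Q (Measure.dirac x₀)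
    have hF (ρ : Measure X) : (fun ρ : Measure X => ρ.bind Q) ρ = ρ.bind Q := rfl
    generalize (fun ρ : Measure X => ρ.bind Q) = F at hstart hprob hF
    refine ⟨fun N => F^[N] (Measure.dirac x₀), hprob, fun N => ?_,
      dTV (Measure.dirac x₀) ((Measure.dirac x₀).bind Q), fun N => ?_⟩
    · beta_reduce
      rw [Function.iterate_succ_apply', hF]
    · beta_reduce
      rw [Function.iterate_succ_apply, hF]
      exact hstart N
  have hstep : ∀ A, MeasurableSet A → ∀ N,
      dist ((μ N).real A) ((μ (N + 1)).real A) ≤ C * c ^ N := fun A hA N => by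
    rw [mul_comm, Real.dist_eq]
    exact (abs_real_sub_le_dTV _ _ hA).trans (hdist N)
  have hlim : ∀ A, ∃ a, MeasurableSet A →
      Filter.Tendsto (fun N => (μ N).real A) Filter.atTop (nhds a) := fun A => by
    by_cases hA : MeasurableSet A
    · obtain ⟨a, ha⟩ := cauchySeq_tendsto_of_complete
        (cauchySeq_of_le_geometric c C hc1 (hstep A hA))
      exact ⟨a, fun _ => ha⟩
    · exact ⟨0, fun hA' => absurd hA' hA⟩
  choose m hm using hlim
  have he : Filter.Tendsto (fun N => C * c ^ N / (1 - c)) Filter.atTop (nhds 0) := by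
    simpa using ((tendsto_pow_atTop_nhds_zero_of_lt_one hc hc1).const_mul C).div_const (1 - c)
  obtain ⟨ν, hν, hνd⟩ := exists_isProbabilityMeasure_of_uniform_limit μ m _ he fun N A hA => by
    rw [← Real.dist_eq]
    exact dist_le_of_le_geometric_of_tendsto c C hc1 (hstep A hA) (hm A hA) N
  refine ⟨ν, hν, (eq_of_dTV_le_zero ?_).symm⟩
  have hsymm : ∀ N, dTV ν (μ N) ≤ C * c ^ N / (1 - c) := fun N => dTV_le fun A hA => by
    rw [abs_sub_comm]
    exact (abs_real_sub_le_dTV _ _ hA).trans (hνd N)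
  have hbound : ∀ N, dTV ν (ν.bind Q) ≤
      C * c ^ (N + 1) / (1 - c) + c * (C * c ^ N / (1 - c)) := fun N => by
    refine (dTV_triangle ν (μ (N + 1)) _).trans (add_le_add (hsymm _) ?_)
    rw [hμs N]
    exact (dTV_bind_le Q hc h _ _).trans (mul_le_mul_of_nonneg_left (hνd N) hc)
  refine ge_of_tendsto' (x := Filter.atTop) ?_ hbound
  simpa using (he.comp (Filter.tendsto_add_atTop_nat 1)).add (he.const_mul c)

end Dobrushin

section Gibbs

variable {n : ℕ} {Θ : Fin n → Type*} [∀ j, MeasurableSpace (Θ j)]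

/-- The kernel on the product space that redraws coordinate `ℓ` from `K ℓ`. -/
noncomputable def gibbsUpdate (K : (ℓ : Fin n) → Kernel ((j : {j : Fin n // j ≠ ℓ}) → Θ j) (Θ ℓ))
    (ℓ : Fin n) : Kernel (∀ j, Θ j) (∀ j, Θ j) :=
  (Kernel.id ×ₖ (K ℓ).comap (fun θ (j : {j : Fin n // j ≠ ℓ}) => θ j.1) (by fun_prop)).map
    fun p => Function.update p.1 ℓ p.2

/-- The kernel performing the updates listed in `L`, from left to right. -/
noncomputable def gibbsSweep (K : (ℓ : Fin n) → Kernel ((j : {j : Fin n // j ≠ ℓ}) → Θ j) (Θ ℓ)) :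
    List (Fin n) → Kernel (∀ j, Θ j) (∀ j, Θ j)
  | [] => Kernel.id
  | ℓ :: L => gibbsSweep K L ∘ₖ gibbsUpdate K ℓ

variable (K : (ℓ : Fin n) → Kernel ((j : {j : Fin n // j ≠ ℓ}) → Θ j) (Θ ℓ))
  [∀ ℓ, IsMarkovKernel (K ℓ)]

lemma gibbsUpdate_apply (ℓ : Fin n) (θ : ∀ j, Θ j) :
    gibbsUpdate K ℓ θ = (K ℓ fun j => θ j.1).map fun t => Function.update θ ℓ t := by
  rw [gibbsUpdate, Kernel.map_apply _ measurable_update', Kernel.prod_apply, Kernel.id_apply,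
    Kernel.comap_apply, Measure.dirac_prod,
    Measure.map_map measurable_update' measurable_prodMk_left]
  rfl

instance (ℓ : Fin n) : IsMarkovKernel (gibbsUpdate K ℓ) :=
  Kernel.IsMarkovKernel.map _ measurable_update'

instance (L : List (Fin n)) : IsMarkovKernel (gibbsSweep K L) := by
  induction L with
  | nil => exact inferInstanceAs (IsMarkovKernel Kernel.id)
  | cons ℓ L ih => exact inferInstanceAs (IsMarkovKernel (gibbsSweep K L ∘ₖ gibbsUpdate K ℓ))

lemma foldl_bind_eq_bind_gibbsSweep (L : List (Fin n)) (ν : Measure (∀ j, Θ j)) :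
    L.foldl (fun ν' ℓ => ν'.bind fun θ =>
      (K ℓ (fun j => θ j.1)).map (fun t => Function.update θ ℓ t)) ν =
      ν.bind (gibbsSweep K L) := by
  induction L generalizing ν with
  | nil => exact Measure.id_comp.symm
  | cons ℓ L ih =>
    rw [List.foldl_cons, ih]
    simp only [← gibbsUpdate_apply]
    exact Measure.comp_assoc

lemma gibbsSweep_cons_real (ℓ : Fin n) (L : List (Fin n)) (θ : ∀ j, Θ j)
    {A : Set (∀ j, Θ j)} (hA : MeasurableSet A) :
    (gibbsSweep K (ℓ :: L) θ).real A =
      ∫ t, (gibbsSweep K L (Function.update θ ℓ t)).real A ∂(K ℓ fun j => θ j.1) := by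
  have : gibbsSweep K (ℓ :: L) θ = (gibbsUpdate K ℓ θ).bind (gibbsSweep K L) := rfl
  rw [this, measureReal_bind_kernel _ _ hA, gibbsUpdate_apply,
    integral_map (measurable_update θ).aemeasurable
      (measurable_kernel_real _ hA).aestronglyMeasurable]

/-- Sweeping an increasing list of coordinates from two states that agree off the list yields
laws whose values differ by at most `1 - ∏ (1 - 2 κ)`. -/
lemma gibbsSweep_real_sub_le {κ : Fin n → ℝ} (hκhalf : ∀ ℓ, κ ℓ < 1 / 2)
    (hcontr : ∀ ℓ : Fin n, ∀ a b : (j : {j : Fin n // j ≠ ℓ}) → Θ j,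
      (∀ j : {j : Fin n // j ≠ ℓ}, (j : Fin n) < ℓ → a j = b j) →
      dTV (K ℓ a) (K ℓ b) ≤ 2 * κ ℓ)
    {A : Set (∀ j, Θ j)} (hA : MeasurableSet A) (L : List (Fin n)) (hL : L.Pairwise (· < ·))
    (θ θ' : ∀ j, Θ j) (h : ∀ j, j ∉ L → θ j = θ' j) :
    (gibbsSweep K L θ).real A - (gibbsSweep K L θ').real A ≤
      1 - (L.map fun ℓ => 1 - 2 * κ ℓ).prod := by
  induction L generalizing θ θ' with
  | nil =>
    obtain rfl : θ = θ' := funext fun j => h j List.not_mem_nil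
    simp
  | cons ℓ L ih =>
    rw [List.pairwise_cons] at hL
    rw [gibbsSweep_cons_real K ℓ L θ hA, gibbsSweep_cons_real K ℓ L θ' hA, List.map_cons,
      List.prod_cons]
    have hmeas : ∀ θ : ∀ j, Θ j,
        Measurable fun t => (gibbsSweep K L (Function.update θ ℓ t)).real A := fun θ =>
      (measurable_kernel_real _ hA).comp (measurable_update θ)
    have hprod : 0 ≤ (L.map fun ℓ => 1 - 2 * κ ℓ).prod :=
      List.prod_nonneg fun x hx => by
        obtain ⟨j, -, rfl⟩ := List.mem_map.1 hx
        linarith [hκhalf j]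
    have hd : dTV (K ℓ fun j => θ j.1) (K ℓ fun j => θ' j.1) ≤ 2 * κ ℓ :=
      hcontr ℓ _ _ fun j hj => h j fun hmem => by
        rcases List.mem_cons.1 hmem with hjℓ | hjL
        · exact j.2 hjℓ
        · exact lt_asymm hj (hL.1 _ hjL)
    refine (integral_sub_integral_le_of_dTV_le (hmeas θ) (hmeas θ')
      (fun _ => ⟨measureReal_nonneg, measureReal_le_one⟩)
      (fun _ => ⟨measureReal_nonneg, measureReal_le_one⟩) (sub_le_self 1 hprod)
      (fun t => ih hL.2 _ _ fun j hj => ?_) hd).trans_eq (by ring)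
    by_cases hjℓ : j = ℓ
    · subst hjℓ; simp
    · simpa [hjℓ] using h j (by simp [hjℓ, hj])

end Gibbs

/-- Theorem 2 of the paper: the `n`-component ABC-Gibbs sweep kernel `G`
(updating coordinate `ℓ` from the kernel `K ℓ`, which depends on all other
coordinates, successively for `ℓ = 1, …, n`) converges geometrically in total
variation to a unique stationary distribution, with per-sweep contraction
factor `1 − ∏ℓ (1 − 2κℓ)`, provided each `K ℓ` satisfies a `2κℓ < 1` total
variation bound uniformly over the not-yet-updated coordinates `θ_{>ℓ}`. -/
theorem stmt_4 {n : ℕ} (hn : 1 ≤ n) (Θ : Fin n → Type*)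
    [∀ j, MeasurableSpace (Θ j)] [∀ j, Nonempty (Θ j)]
    (K : (ℓ : Fin n) → Kernel ((j : {j : Fin n // j ≠ ℓ}) → Θ j) (Θ ℓ))
    [∀ ℓ, IsMarkovKernel (K ℓ)]
    (G : Measure (∀ j, Θ j) → Measure (∀ j, Θ j))
    (hG : ∀ ν : Measure (∀ j, Θ j), G ν = (List.finRange n).foldl
      (fun ν' ℓ => ν'.bind (fun θ =>
        (K ℓ (fun j => θ j.1)).map (fun t => Function.update θ ℓ t))) ν)
    (κ : Fin n → ℝ) (hκ0 : ∀ ℓ, 0 ≤ κ ℓ) (hκhalf : ∀ ℓ, κ ℓ < 1/2)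
    (hcontr : ∀ ℓ : Fin n, ∀ a b : (j : {j : Fin n // j ≠ ℓ}) → Θ j,
      (∀ j : {j : Fin n // j ≠ ℓ}, (j : Fin n) < ℓ → a j = b j) →
      dTV (K ℓ a) (K ℓ b) ≤ 2 * κ ℓ) :
    ∃ νε : Measure (∀ j, Θ j), IsProbabilityMeasure νε ∧ G νε = νε ∧
      (∀ ν' : Measure (∀ j, Θ j), IsProbabilityMeasure ν' → G ν' = ν' → ν' = νε) ∧
      ∀ ν : Measure (∀ j, Θ j), IsProbabilityMeasure ν → ∀ N : ℕ,
        dTV (G^[N] ν) νε ≤ (1 - ∏ ℓ, (1 - 2 * κ ℓ)) ^ N * dTV ν νε := by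
  obtain rfl : G = fun ν => ν.bind (gibbsSweep K (List.finRange n)) := funext fun ν =>
    (hG ν).trans (foldl_bind_eq_bind_gibbsSweep K _ ν)
  set c := 1 - ∏ ℓ, (1 - 2 * κ ℓ) with hc
  have hpos : 0 < ∏ ℓ, (1 - 2 * κ ℓ) := Finset.prod_pos fun ℓ _ => by linarith [hκhalf ℓ]
  have hle : ∏ ℓ, (1 - 2 * κ ℓ) ≤ 1 := Finset.prod_le_one
    (fun ℓ _ => by linarith [hκhalf ℓ]) (fun ℓ _ => by linarith [hκ0 ℓ])
  have hc0 : 0 ≤ c := by linarith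
  have hc1 : c < 1 := by linarith
  have hosc : ∀ A, MeasurableSet A → ∀ θ θ' : ∀ j, Θ j,
      (gibbsSweep K (List.finRange n) θ).real A - (gibbsSweep K (List.finRange n) θ').real A
        ≤ c := fun A hA θ θ' => by
    rw [hc, Fin.prod_univ_def]
    exact gibbsSweep_real_sub_le K hκhalf hcontr hA _ (List.pairwise_lt_finRange n) θ θ'
      fun j hj => absurd (List.mem_finRange j) hj
  obtain ⟨νε, hνε, hinv⟩ := exists_invariant_of_contraction _ hc0 hc1 hosc
  refine ⟨νε, hνε, hinv, fun ν' hν' hinv' => eq_of_dTV_le_zero ?_, fun ν hν N => ?_⟩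
  · have := dTV_bind_le _ hc0 hosc ν' νε
    rw [hinv, show ν'.bind (gibbsSweep K (List.finRange n)) = ν' from hinv'] at this
    nlinarith [dTV_nonneg ν' νε]
  · have := dTV_iterate_bind_le _ hc0 hosc ν νε N
    rwa [Function.iterate_fixed (f := fun ρ : Measure (∀ j, Θ j) => ρ.bind _) hinv N] at this
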